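/- (Explicit characterization of the preimage of the forward map.) Assume φ'_0 = −∞. Let μ, ν ∈ ℝ^n be probability vectors and let X̂ ∈ U(μ,ν) have every entry X̂_{ij} ∈ int(I). Set M := max_{i,j} φ'(X̂_{ij}). Then for any C ∈ ℝ^{n×n}, X̂ is the unique minimizer of J_C over U_I(μ,ν) if and only if there exist vectors a, b ∈ ℝ^n such that C_{ij} = γ(M − φ'(X̂_{ij})) + a_i + b_j for all i,j. In particular, the matrix Ĉ with entries Ĉ_{ij} = γ(M − φ'(X̂_{ij})) has all entries nonnegative and X̂ is the unique minimizer of J_{Ĉ} over U_I(μ,ν). -/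

import Mathlib

open Filter Set Topology

namespace IOT

/-- `μ` is a probability vector. -/
def ProbVec {n : ℕ} (μ : Fin n → ℝ) : Prop :=
  (∀ i, 0 ≤ μ i) ∧ (∑ i, μ i) = 1

/-- `X` belongs to the transport polytope `U(μ,ν)`. -/
def MemU {n : ℕ} (μ ν : Fin n → ℝ) (X : Fin n → Fin n → ℝ) : Prop :=
  (∀ i j, 0 ≤ X i j) ∧ (∀ i, (∑ j, X i j) = μ i) ∧ (∀ j, (∑ i, X i j) = ν j)

/-- `X ∈ U(μ,ν)` with all entries in `I`. -/
def MemUI {n : ℕ} (μ ν : Fin n → ℝ) (I : Set ℝ) (X : Fin n → Fin n → ℝ) : Prop :=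
  MemU μ ν X ∧ ∀ i j, X i j ∈ I

/-- The regularized transport objective `J_C(X) = ⟨C,X⟩ + γ Σ φ(X_ij)`. -/
noncomputable def JCost {n : ℕ} (γ : ℝ) (φ : ℝ → ℝ) (C X : Fin n → Fin n → ℝ) : ℝ :=
  (∑ i, ∑ j, C i j * X i j) + γ * ∑ i, ∑ j, φ (X i j)

/-- `Xh` is the unique minimizer of `J_C` over `U_I(μ,ν)`. -/
def UniqueMin {n : ℕ} (μ ν : Fin n → ℝ) (I : Set ℝ) (γ : ℝ) (φ : ℝ → ℝ)
    (C Xh : Fin n → Fin n → ℝ) : Prop :=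
  MemUI μ ν I Xh ∧ ∀ X, MemUI μ ν I X → X ≠ Xh → JCost γ φ C Xh < JCost γ φ C X

/-- Membership in `S_h`: nonnegative, symmetric, zero diagonal. -/
def MemSh {n : ℕ} (C : Fin n → Fin n → ℝ) : Prop :=
  (∀ i j, 0 ≤ C i j) ∧ (∀ i j, C i j = C j i) ∧ (∀ i, C i i = 0)

/-- The recovery matrix `G(X)_{ij} = (γ/2)(φ'(X_ii)+φ'(X_jj)-φ'(X_ij)-φ'(X_ji))`. -/
noncomputable def Gmat {n : ℕ} (γ : ℝ) (φ' : ℝ → ℝ) (X : Fin n → Fin n → ℝ) : Fin n → Fin n → ℝ :=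
  fun i j => γ / 2 * (φ' (X i i) + φ' (X j j) - φ' (X i j) - φ' (X j i))

/-- The Bregman divergence `B_φ(x ‖ y)`. -/
noncomputable def Breg (φ φ' : ℝ → ℝ) (x y : ℝ) : ℝ := φ x - φ y - (x - y) * φ' y

end IOT

namespace IOT

/-- A convex function which is strictly convex on the interior lies strictly above its tangents
at interior points. -/
lemma tangent_lt {I : Set ℝ} {φ : ℝ → ℝ} {d x y : ℝ} (hφconv : ConvexOn ℝ I φ)
    (hφstrict : StrictConvexOn ℝ (interior I) φ) (hx : x ∈ I) (hy : y ∈ interior I)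
    (hd : HasDerivAt φ d y) (hxy : x ≠ y) : φ y + d * (x - y) < φ x := by
  have hz : (1 / 2 : ℝ) • y + (1 / 2 : ℝ) • x ∈ interior I :=
    hφconv.1.combo_interior_self_mem_interior hy hx (by norm_num) (by norm_num) (by norm_num)
  have hmid := hφconv.2 (interior_subset hy) hx (by norm_num : (0 : ℝ) ≤ 1 / 2)
    (by norm_num : (0 : ℝ) ≤ 1 / 2) (by norm_num)
  set z := (1 / 2 : ℝ) • y + (1 / 2 : ℝ) • x with hzdef
  simp only [smul_eq_mul] at hmid hzdef
  have htangent : φ y + d * (z - y) < φ z := by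
    rcases lt_or_gt_of_ne hxy with h | h
    · have hs := hφstrict.slope_lt_of_hasDerivAt hz hy (by linarith) hd
      rw [slope_def_field, div_lt_iff₀ (by linarith)] at hs
      linarith
    · have hs := hφstrict.lt_slope_of_hasDerivAt hy hz (by linarith) hd
      rw [slope_def_field, lt_div_iff₀ (by linarith)] at hs
      linarith
  have hzy : z - y = (x - y) / 2 := by linarith
  rw [hzy] at htangent
  linarith

/-- The interior points of the domain exclude `0` when `φ'` blows up there. -/
lemma zero_notMem_interior {I : Set ℝ} {φ' : ℝ → ℝ} (hφ'cont : ContinuousOn φ' (interior I))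
    (hφ'0 : Tendsto φ' (𝓝[>] (0 : ℝ)) atBot) : (0 : ℝ) ∉ interior I := fun h =>
  not_tendsto_nhds_of_tendsto_atBot hφ'0 (φ' 0)
    ((hφ'cont.continuousAt (isOpen_interior.mem_nhds h)).tendsto.mono_left nhdsWithin_le_nhds)

/-- An additively separable matrix pairs equally with all elements of a transport polytope. -/
lemma sum_separable_mul {n : ℕ} {μ ν : Fin n → ℝ} {X : Fin n → Fin n → ℝ} (hX : MemU μ ν X)
    (a b : Fin n → ℝ) :
    ∑ i, ∑ j, (a i + b j) * X i j = ∑ i, a i * μ i + ∑ j, b j * ν j := by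
  simp only [add_mul, Finset.sum_add_distrib]
  congr 1
  · simp only [← Finset.mul_sum, hX.2.1]
  · rw [Finset.sum_comm]
    simp only [← Finset.mul_sum, hX.2.2]

lemma JCost_eq_sum {n : ℕ} (γ : ℝ) (φ : ℝ → ℝ) (C X : Fin n → Fin n → ℝ) :
    JCost γ φ C X = ∑ i, ∑ j, (C i j * X i j + γ * φ (X i j)) := by
  simp only [JCost, Finset.sum_add_distrib, Finset.mul_sum]

/-- If the gradient of the objective at an interior point is additively separable, then that point
is the unique minimizer. -/
lemma uniqueMin_of_separable {n : ℕ} {I : Set ℝ} {φ φ' : ℝ → ℝ} (hφconv : ConvexOn ℝ I φ)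
    (hφderiv : ∀ x ∈ interior I, HasDerivAt φ (φ' x) x)
    (hφstrict : StrictConvexOn ℝ (interior I) φ) {γ : ℝ} (hγ : 0 < γ) {μ ν : Fin n → ℝ}
    {C Xh : Fin n → Fin n → ℝ} (hXhU : MemU μ ν Xh) (hXhI : ∀ i j, Xh i j ∈ interior I)
    {a b : Fin n → ℝ} (hC : ∀ i j, C i j + γ * φ' (Xh i j) = a i + b j) :
    UniqueMin μ ν I γ φ C Xh := by
  refine ⟨⟨hXhU, fun i j => interior_subset (hXhI i j)⟩, fun X hX hne => ?_⟩
  obtain ⟨k, l, hkl⟩ : ∃ k l, X k l ≠ Xh k l := by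
    by_contra! h
    exact hne (funext fun k => funext fun l => h k l)
  have key : ∀ i j, X i j ≠ Xh i j →
      C i j * Xh i j + γ * φ (Xh i j) + ((a i + b j) * X i j - (a i + b j) * Xh i j) <
        C i j * X i j + γ * φ (X i j) := fun i j h => by
    have ht := mul_lt_mul_of_pos_left
      (tangent_lt hφconv hφstrict (hX.2 i j) (hXhI i j) (hφderiv _ (hXhI i j)) h) hγ
    rw [← hC]
    linarith
  have key' : ∀ i j,
      C i j * Xh i j + γ * φ (Xh i j) + ((a i + b j) * X i j - (a i + b j) * Xh i j) ≤
        C i j * X i j + γ * φ (X i j) := fun i j => by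
    by_cases h : X i j = Xh i j
    · simp [h]
    · exact (key i j h).le
  have hlt : ∑ i, ∑ j,
      (C i j * Xh i j + γ * φ (Xh i j) + ((a i + b j) * X i j - (a i + b j) * Xh i j)) <
        ∑ i, ∑ j, (C i j * X i j + γ * φ (X i j)) :=
    Finset.sum_lt_sum (fun i _ => Finset.sum_le_sum fun j _ => key' i j)
      ⟨k, Finset.mem_univ k, Finset.sum_lt_sum (fun j _ => key' k j)
        ⟨l, Finset.mem_univ l, key k l hkl⟩⟩
  rw [JCost_eq_sum, JCost_eq_sum]
  refine lt_of_eq_of_lt ?_ hlt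
  simp only [Finset.sum_add_distrib (f := fun j => C _ j * Xh _ j + γ * φ (Xh _ j)),
    Finset.sum_add_distrib (f := fun i => ∑ j, (C i j * Xh i j + γ * φ (Xh i j))),
    Finset.sum_sub_distrib, sum_separable_mul hX.1, sum_separable_mul hXhU, sub_self, add_zero]

/-- First-order optimality: at a positive interior minimizer the gradient of the objective is
orthogonal to every rank-one perturbation preserving the marginals. -/
lemma sum_gradient_mul_eq_zero {n : ℕ} {I : Set ℝ} {φ φ' : ℝ → ℝ}
    (hφderiv : ∀ x ∈ interior I, HasDerivAt φ (φ' x) x) {γ : ℝ} {μ ν : Fin n → ℝ}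
    {C Xh : Fin n → Fin n → ℝ} (hXhI : ∀ i j, Xh i j ∈ interior I) (hpos : ∀ i j, 0 < Xh i j)
    (hmin : UniqueMin μ ν I γ φ C Xh) {u v : Fin n → ℝ} (hu : ∑ i, u i = 0)
    (hv : ∑ j, v j = 0) :
    ∑ i, ∑ j, (C i j + γ * φ' (Xh i j)) * (u i * v j) = 0 := by
  have hline : ∀ i j, HasDerivAt (fun t : ℝ => Xh i j + t * (u i * v j)) (u i * v j) 0 :=
    fun i j => by
      simpa using ((hasDerivAt_id (0 : ℝ)).mul_const (u i * v j)).const_add (Xh i j)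
  have hderiv : HasDerivAt
      (fun t : ℝ => JCost γ φ C (fun i j => Xh i j + t * (u i * v j)))
      (∑ i, ∑ j, (C i j + γ * φ' (Xh i j)) * (u i * v j)) 0 := by
    simp only [JCost_eq_sum]
    refine HasDerivAt.fun_sum fun i _ => HasDerivAt.fun_sum fun j _ => ?_
    have hφ : HasDerivAt φ (φ' (Xh i j)) (Xh i j + 0 * (u i * v j)) := by
      simpa using hφderiv _ (hXhI i j)
    exact (((hline i j).const_mul (C i j)).fun_add
      ((hφ.comp (0 : ℝ) (hline i j)).const_mul γ)).congr_deriv (by ring)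
  refine IsLocalMin.hasDerivAt_eq_zero ?_ hderiv
  have hev : ∀ i j, ∀ᶠ t : ℝ in 𝓝 0,
      Xh i j + t * (u i * v j) ∈ interior I ∩ Set.Ioi 0 := fun i j =>
    (hline i j).continuousAt.eventually_mem
      ((isOpen_interior.inter isOpen_Ioi).mem_nhds (by simpa using ⟨hXhI i j, hpos i j⟩))
  filter_upwards [eventually_all.2 fun i => eventually_all.2 (hev i)] with t ht
  by_cases h : (fun i j => Xh i j + t * (u i * v j)) = Xh
  · simp [h]
  · simp only [zero_mul, add_zero]
    refine (hmin.2 _ ⟨⟨fun i j => (ht i j).2.le, fun i => ?_, fun j => ?_⟩,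
      fun i j => interior_subset (ht i j).1⟩ h).le
    · simp [Finset.sum_add_distrib, ← Finset.mul_sum, hv, hmin.1.1.2.1]
    · simp [Finset.sum_add_distrib, ← Finset.mul_sum, ← Finset.sum_mul, hu, hmin.1.1.2.2]

/-- A matrix orthogonal to all products of zero-sum vectors is additively separable. -/
lemma exists_separable {n : ℕ} (hn : 0 < n) {G : Fin n → Fin n → ℝ}
    (hG : ∀ u v : Fin n → ℝ, ∑ i, u i = 0 → ∑ j, v j = 0 →
      ∑ i, ∑ j, G i j * (u i * v j) = 0) :
    ∃ a b : Fin n → ℝ, ∀ i j, G i j = a i + b j := by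
  let z : Fin n := ⟨0, hn⟩
  refine ⟨fun i => G i z - G z z, fun j => G z j, fun i j => ?_⟩
  have h := hG (fun k => (if k = i then 1 else 0) - (if k = z then 1 else 0))
    (fun l => (if l = j then 1 else 0) - (if l = z then 1 else 0)) (by simp) (by simp)
  simp only [mul_sub, mul_ite, mul_one, mul_zero, Finset.sum_sub_distrib,
    Finset.sum_ite_eq', Finset.mem_univ, if_true] at h
  linarith

/-- explicit characterization of the preimage of the forward map
when `φ'_0 = -∞`, where `M = max_{i,j} φ'(Xh i j)`. -/
theorem stmt3 {n : ℕ} (hn : 0 < n)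
    (I : Set ℝ) (hIoc : I.OrdConnected) (hI01 : Set.Ioo (0:ℝ) 1 ⊆ interior I)
    (φ φ' : ℝ → ℝ)
    (hφcont : ContinuousOn φ I)
    (hφconv : ConvexOn ℝ I φ)
    (hφderiv : ∀ x ∈ interior I, HasDerivAt φ (φ' x) x)
    (hφ'cont : ContinuousOn φ' (interior I))
    (hφstrict : StrictConvexOn ℝ (interior I) φ)
    (hφ'0 : Tendsto φ' (𝓝[>] (0:ℝ)) atBot)
    (γ : ℝ) (hγ : 0 < γ)
    (μ ν : Fin n → ℝ) (hμ : ProbVec μ) (hν : ProbVec ν)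
    (Xh : Fin n → Fin n → ℝ) (hXhU : MemU μ ν Xh)
    (hXhI : ∀ i j, Xh i j ∈ interior I)
    (M : ℝ) (hM : IsGreatest {y : ℝ | ∃ i j, y = φ' (Xh i j)} M) :
    (∀ C : Fin n → Fin n → ℝ,
      UniqueMin μ ν I γ φ C Xh ↔
        ∃ a b : Fin n → ℝ, ∀ i j, C i j = γ * (M - φ' (Xh i j)) + a i + b j) ∧
    (∀ i j, 0 ≤ γ * (M - φ' (Xh i j))) ∧
    UniqueMin μ ν I γ φ (fun i j => γ * (M - φ' (Xh i j))) Xh := by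
  have hpos : ∀ i j, 0 < Xh i j := fun i j => (hXhU.1 i j).lt_of_ne fun h =>
    zero_notMem_interior hφ'cont hφ'0 (h ▸ hXhI i j)
  refine ⟨fun C => ⟨fun hmin => ?_, ?_⟩, fun i j => ?_, ?_⟩
  · obtain ⟨a, b, hab⟩ := exists_separable hn fun u v hu hv =>
      sum_gradient_mul_eq_zero hφderiv hXhI hpos hmin hu hv
    exact ⟨fun i => a i - γ * M, b, fun i j => by linarith [hab i j]⟩
  · rintro ⟨a, b, hab⟩
    refine uniqueMin_of_separable (a := fun i => a i + γ * M) (b := b) hφconv hφderiv hφstrict hγ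
      hXhU hXhI fun i j => ?_
    rw [hab]
    ring
  · exact mul_nonneg hγ.le (sub_nonneg.2 (hM.2 ⟨i, j, rfl⟩))
  · exact uniqueMin_of_separable (a := fun _ => γ * M) (b := fun _ => 0) hφconv hφderiv hφstrict hγ
      hXhU hXhI fun i j => by ring

end IOT
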